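/- Let R be an associative ring with identity and let (A,B) be a hereditary cotorsion pair in Mod R. Let U be an acyclic cochain complex of left R-modules such that U^s ∈ A and Z^s(U) ∈ A for every s ∈ ℤ, and let Y be a CE B complex. Then the Hom complex Hom_R(U,Y) — the cochain complex of abelian groups whose degree-n component is ∏_{i∈ℤ} Hom_R(U^i, Y^{i+n}) with the usual differential — is acyclic. (Key step in the proof of Lemma 2.4, via an inverse limit of the bounded-below truncations of Y.) -/

import Mathlib

open CategoryTheory Limits DerivedCategory Pretriangulated

noncomputable section

universe w u

variable {R : Type u} [Ring R]

def Ext1Zero [HasExt.{w} (ModuleCat.{u} R)] (A B : ModuleCat.{u} R) : Prop :=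
  Subsingleton (Abelian.Ext A B 1)

def IsSES {K M N : ModuleCat.{u} R} (i : K ⟶ M) (p : M ⟶ N) : Prop :=
  Function.Injective i ∧ Function.Surjective p ∧ Function.Exact i p

def IsCotorsionPair [HasExt.{w} (ModuleCat.{u} R)] (A B : Set (ModuleCat.{u} R)) : Prop :=
  (∀ M : ModuleCat.{u} R, M ∈ A ↔ ∀ N ∈ B, Ext1Zero M N) ∧
  (∀ N : ModuleCat.{u} R, N ∈ B ↔ ∀ M ∈ A, Ext1Zero M N)

def IsCompleteCP (A B : Set (ModuleCat.{u} R)) : Prop :=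
  ∀ M : ModuleCat.{u} R,
    (∃ (B' A' : ModuleCat.{u} R) (i : B' ⟶ A') (p : A' ⟶ M),
      B' ∈ B ∧ A' ∈ A ∧ IsSES i p) ∧
    (∃ (B' A' : ModuleCat.{u} R) (i : M ⟶ B') (p : B' ⟶ A'),
      B' ∈ B ∧ A' ∈ A ∧ IsSES i p)

def IsHereditaryCP (A B : Set (ModuleCat.{u} R)) : Prop :=
  (∀ (K A₁ A₂ : ModuleCat.{u} R) (i : K ⟶ A₁) (p : A₁ ⟶ A₂),
    A₁ ∈ A → A₂ ∈ A → IsSES i p → K ∈ A) ∧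
  (∀ (B₁ B₂ K : ModuleCat.{u} R) (i : B₁ ⟶ B₂) (p : B₂ ⟶ K),
    B₁ ∈ B → B₂ ∈ B → IsSES i p → K ∈ B)

def IsCE (S : Set (ModuleCat.{u} R)) (W : CochainComplex (ModuleCat.{u} R) ℤ) : Prop :=
  ∀ s : ℤ, W.X s ∈ S ∧ W.cycles s ∈ S ∧ image (W.d (s-1) s) ∈ S ∧ W.homology s ∈ S

namespace CategoryTheory.ShortComplex.ShortExact

variable {C : Type*} [Category* C] [Abelian C] [HasExt.{w} C] {S : ShortComplex C}

lemma exists_extension (hS : S.ShortExact) {N : C}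
    (h : Subsingleton (Abelian.Ext S.X₃ N 1)) (f : S.X₁ ⟶ N) :
    ∃ g : S.X₂ ⟶ N, S.f ≫ g = f := by
  obtain ⟨x, hx⟩ := Abelian.Ext.contravariant_sequence_exact₁ hS N
    (Abelian.Ext.mk₀ f) (add_zero 1) (Subsingleton.elim _ _)
  obtain ⟨g, rfl⟩ := Abelian.Ext.homEquiv₀.symm.surjective x
  refine ⟨g, Abelian.Ext.homEquiv₀.symm.injective ?_⟩
  exact (Abelian.Ext.mk₀_comp_mk₀ _ _).symm.trans hx

lemma exists_lift (hS : S.ShortExact) {M : C}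
    (h : Subsingleton (Abelian.Ext M S.X₁ 1)) (f : M ⟶ S.X₃) :
    ∃ g : M ⟶ S.X₂, g ≫ S.g = f := by
  obtain ⟨x, hx⟩ := Abelian.Ext.covariant_sequence_exact₃ M hS
    (Abelian.Ext.mk₀ f) (zero_add 1) (Subsingleton.elim _ _)
  obtain ⟨g, rfl⟩ := Abelian.Ext.homEquiv₀.symm.surjective x
  refine ⟨g, Abelian.Ext.homEquiv₀.symm.injective ?_⟩
  exact (Abelian.Ext.mk₀_comp_mk₀ _ _).symm.trans hx

end CategoryTheory.ShortComplex.ShortExact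

namespace CochainComplex

variable {C : Type*} [Category* C] [Abelian C]

/-- If the differential `d i j` factors as an epimorphism `e` followed by a monomorphism, then
the cycles in degree `i` are the kernel of `e`. -/
lemma shortExact_iCycles (K : CochainComplex C ℤ) {i j : ℤ} (hij : i + 1 = j) {I : C}
    (e : K.X i ⟶ I) (m : I ⟶ K.X j) (fac : e ≫ m = K.d i j) [Epi e] [Mono m] :
    ∃ w : K.iCycles i ≫ e = 0, (ShortComplex.mk (K.iCycles i) e w).ShortExact := by
  have w : K.iCycles i ≫ e = 0 := by
    rw [← cancel_mono m, Category.assoc, fac, K.iCycles_d, zero_comp]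
  exact ⟨w, ShortComplex.ShortExact.mk (ShortComplex.exact_of_f_is_kernel _
    (isKernelOfComp _ _ (K.cyclesIsKernel i j (by simpa using hij)) w fac))⟩

lemma epi_toCycles {K : CochainComplex C ℤ} {i j : ℤ} (hij : i + 1 = j) (hK : K.ExactAt j) :
    Epi (K.toCycles i j) := by
  obtain rfl : (ComplexShape.up ℤ).prev j = i := by simp [← hij]
  exact ShortComplex.Exact.epi_toCycles hK

/-- For an acyclic complex `K`, a morphism from `K.X j` that vanishes on the boundaries extends
along the differential when `Ext¹` out of the cycles vanishes. -/
lemma exists_d_comp_eq [HasExt.{w} C] {K : CochainComplex C ℤ} (hK : ∀ i, K.ExactAt i) {N : C}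
    (hN : ∀ i, Subsingleton (Abelian.Ext (K.cycles i) N 1)) {i j k : ℤ}
    (hij : i + 1 = j) (hjk : j + 1 = k) (f : K.X j ⟶ N) (hf : K.d i j ≫ f = 0) :
    ∃ g : K.X k ⟶ N, K.d j k ≫ g = f := by
  have := epi_toCycles hij (hK j)
  have := epi_toCycles hjk (hK k)
  have := epi_toCycles rfl (hK (k + 1))
  obtain ⟨_, hS⟩ := K.shortExact_iCycles hjk _ _ (K.toCycles_i j k)
  obtain ⟨l, hl⟩ := hS.exact.desc' f <| by
    rw [← cancel_epi (K.toCycles i j), K.toCycles_i_assoc, hf, comp_zero]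
  obtain ⟨_, hS'⟩ := K.shortExact_iCycles rfl _ _ (K.toCycles_i k (k + 1))
  obtain ⟨g, hg⟩ := hS'.exists_extension (hN _) l
  exact ⟨g, by rw [← K.toCycles_i, Category.assoc, hg, hl]⟩

namespace HomComplex

variable {K L : CochainComplex C ℤ} {n : ℤ}

lemma v_comp_d_eq_of_δ_eq_zero {z : Cochain K L n} (hz : δ n (n + 1) z = 0) {p p' q q' : ℤ}
    (hpq : p + n = q) (hp : p + 1 = p') (hq : q + 1 = q') :
    z.v p q hpq ≫ L.d q q' = n.negOnePow • K.d p p' ≫ z.v p' q' (by lia) := by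
  have h := Cochain.congr_v hz p q' (by lia)
  rw [δ_v n (n + 1) rfl z p q' (by lia) q p' (by lia) hp] at h
  simpa [Int.negOnePow_succ, add_neg_eq_zero] using h

/-- A degree `n` cocycle with values in the cycles of `L` is a coboundary. -/
lemma exists_δ_eq_of_v_comp_d_eq_zero [HasExt.{w} C] (hK : ∀ i, K.ExactAt i)
    (hZ : ∀ i j, Subsingleton (Abelian.Ext (K.cycles i) (L.cycles j) 1))
    (z : Cochain K L n) (hz : δ n (n + 1) z = 0)
    (hz' : ∀ p q q' (hpq : p + n = q), z.v p q hpq ≫ L.d q q' = 0) :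
    ∃ y : Cochain K L (n - 1), δ (n - 1) n y = z := by
  have key (p p' q : ℤ) (hp : p + 1 = p') (hpq : p' + (n - 1) = q) :
      ∃ g : K.X p' ⟶ L.cycles q, K.d p p' ≫ g ≫ L.iCycles q = z.v p q (by lia) := by
    obtain ⟨g, hg⟩ := exists_d_comp_eq hK (hZ · q) (sub_add_cancel p 1) hp
      (L.liftCycles (z.v p q (by lia)) (q + 1) (by simp) (hz' _ _ _ _)) <| by
        rw [← cancel_mono (L.iCycles q), Category.assoc, L.liftCycles_i, zero_comp]
        have h := v_comp_d_eq_of_δ_eq_zero hz (p := p - 1) (p' := p) (q := q - 1)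
          (q' := q) (by lia) (by lia) (by lia)
        rw [hz'] at h
        simpa [smul_smul] using congrArg (n.negOnePow • ·) h.symm
    exact ⟨g, by rw [← Category.assoc, hg, L.liftCycles_i]⟩
  choose g hg using key
  refine ⟨Cochain.mk fun p q hpq ↦
    n.negOnePow • g (p - 1) p q (sub_add_cancel p 1) hpq ≫ L.iCycles q, ?_⟩
  ext p q hpq
  rw [δ_v (n - 1) n (sub_add_cancel n 1) _ p q hpq (q - 1) (p + 1) rfl rfl]
  have h := hg p (p + 1) q rfl (by omega)
  simp [h, smul_smul]

/-- If the cycles and terms of an acyclic complex `K` have vanishing `Ext¹` into the cycles of `L`,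
and the cycles of `K` also into the boundaries of `L`, then the Hom complex from `K` to `L` is
acyclic. The proof subtracts a coboundary to get a cocycle with values in the cycles of `L`. -/
theorem exists_δ_eq_of_δ_eq_zero [HasExt.{w} C] (hK : ∀ i, K.ExactAt i)
    (hZ : ∀ i j, Subsingleton (Abelian.Ext (K.cycles i) (L.cycles j) 1))
    (hB : ∀ i j, Subsingleton (Abelian.Ext (K.cycles i) (image (L.d (j - 1) j)) 1))
    (hX : ∀ i j, Subsingleton (Abelian.Ext (K.X i) (L.cycles j) 1))
    (z : Cochain K L n) (hz : δ n (n + 1) z = 0) :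
    ∃ y : Cochain K L (n - 1), δ (n - 1) n y = z := by
  have key (p p' q : ℤ) (hp : p + 1 = p') (hpq : p' + (n - 1) = q) : ∃ y : K.X p' ⟶ L.X q,
      K.d p p' ≫ y ≫ L.d q (q + 1) = z.v p q (by lia) ≫ L.d q (q + 1) := by
    obtain ⟨r, rfl⟩ : ∃ r, q = r - 1 := ⟨q + 1, by lia⟩
    rw [sub_add_cancel]
    obtain ⟨v, hv⟩ := exists_d_comp_eq hK (hB · r) (sub_add_cancel p 1) hp
      (z.v p (r - 1) (by lia) ≫ factorThruImage (L.d (r - 1) r)) <| by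
        have h := v_comp_d_eq_of_δ_eq_zero hz (p := p) (p' := p') (q := r - 1)
          (q' := r) (by lia) (by lia) (by lia)
        rw [← cancel_mono (image.ι (L.d (r - 1) r)), Category.assoc, Category.assoc, image.fac,
          zero_comp, h]
        simp
    obtain ⟨_, hS⟩ := L.shortExact_iCycles (by lia) _ _ (image.fac (L.d (r - 1) r))
    obtain ⟨y, hy⟩ := hS.exists_lift (hX p' _) v
    dsimp at hy
    refine ⟨y, ?_⟩
    rw [← image.fac (L.d (r - 1) r), reassoc_of% hy, reassoc_of% hv]
  choose y hy using key
  let y₀ : Cochain K L (n - 1) := Cochain.mk fun p q hpq ↦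
    n.negOnePow • y (p - 1) p q (sub_add_cancel p 1) hpq
  obtain ⟨y₁, hy₁⟩ := exists_δ_eq_of_v_comp_d_eq_zero hK hZ (z - δ (n - 1) n y₀)
    (by rw [δ_sub, hz, δ_δ, sub_zero]) fun p q q' hpq ↦ by
      by_cases hq : q + 1 = q'
      · subst hq
        have h := hy p (p + 1) q rfl (by omega)
        rw [Cochain.sub_v, δ_v (n - 1) n (sub_add_cancel n 1) _ p q hpq (q - 1) (p + 1)
          rfl rfl]
        simp [y₀, h, smul_smul]
      · rw [L.shape _ _ hq, comp_zero]
  exact ⟨y₀ + y₁, by rw [δ_add, hy₁, add_sub_cancel]⟩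

end HomComplex

end CochainComplex

open CochainComplex.HomComplex in
theorem stmt11 [HasExt.{w} (ModuleCat.{u} R)]
    (A B : Set (ModuleCat.{u} R))
    (hcp : IsCotorsionPair A B) (hhered : IsHereditaryCP A B)
    (U Y : CochainComplex (ModuleCat.{u} R) ℤ)
    (hUacyclic : ∀ s : ℤ, U.ExactAt s)
    (hUX : ∀ s : ℤ, U.X s ∈ A) (hUcycles : ∀ s : ℤ, U.cycles s ∈ A)
    (hY : IsCE B Y) :
    ∀ (n : ℤ) (z : Cochain U Y n), δ n (n+1) z = 0 →
      ∃ y : Cochain U Y (n-1), δ (n-1) n y = z := by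
  exact fun n z hz ↦ CochainComplex.HomComplex.exists_δ_eq_of_δ_eq_zero hUacyclic
    (fun i j ↦ (hcp.1 _).1 (hUcycles i) _ (hY j).2.1)
    (fun i j ↦ (hcp.1 _).1 (hUcycles i) _ (hY j).2.2.1)
    (fun i j ↦ (hcp.1 _).1 (hUX i) _ (hY j).2.1) z hz
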